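/- Let A be a classical 𝓛_C-formula and F an intuitionistic ⊥-free formula. Then the sequent A^[F], (A⊥)^[F] ⊢ F is provable in ILLW and also in IELW. -/

import Mathlib

namespace Affine

/-- Intuitionistic formulas: the language 𝓛 (⊗, ⊸, &, ⊕, !, 1, ⊤, ⊥, 0)
together with the extra ILAL modality §. -/
inductive IForm : Type where
  | var (n : ℕ)
  | one
  | top
  | bot
  | zero
  | tensor (A B : IForm)
  | limp (A B : IForm)
  | and (A B : IForm)
  | or (A B : IForm)
  | bang (A : IForm)
  | para (A : IForm)

namespace IForm

/-- membership in the language 𝓛 (no §) -/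
def inL : IForm → Prop
  | para _ => False
  | tensor A B => inL A ∧ inL B
  | limp A B => inL A ∧ inL B
  | and A B => inL A ∧ inL B
  | or A B => inL A ∧ inL B
  | bang A => inL A
  | _ => True

/-- membership in the ⊥-free language 𝓛⁺ -/
def inLp : IForm → Prop
  | para _ => False
  | bot => False
  | tensor A B => inLp A ∧ inLp B
  | limp A B => inLp A ∧ inLp B
  | and A B => inLp A ∧ inLp B
  | or A B => inLp A ∧ inLp B
  | bang A => inLp A
  | _ => True

/-- {⊗,⊸,&,⊕,1,⊥}-formulas -/
def inFLei : IForm → Prop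
  | var _ => True
  | one => True
  | bot => True
  | tensor A B => inFLei A ∧ inFLei B
  | limp A B => inFLei A ∧ inFLei B
  | and A B => inFLei A ∧ inFLei B
  | or A B => inFLei A ∧ inFLei B
  | _ => False

/-- {⊗,⊸,&,⊕,1}-formulas -/
def inFLeiP : IForm → Prop
  | var _ => True
  | one => True
  | tensor A B => inFLeiP A ∧ inFLeiP B
  | limp A B => inFLeiP A ∧ inFLeiP B
  | and A B => inFLeiP A ∧ inFLeiP B
  | or A B => inFLeiP A ∧ inFLeiP B
  | _ => False

/-- purely implicational ({⊸}-) formulas -/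
def inImp : IForm → Prop
  | var _ => True
  | limp A B => inImp A ∧ inImp B
  | _ => False

/-- {⊸,!}-formulas -/
def inImpBang : IForm → Prop
  | var _ => True
  | limp A B => inImpBang A ∧ inImpBang B
  | bang A => inImpBang A
  | _ => False

/-- {⊸,!,§}-formulas: the language of ILAL -/
def inLAL : IForm → Prop
  | var _ => True
  | limp A B => inLAL A ∧ inLAL B
  | bang A => inLAL A
  | para A => inLAL A
  | _ => False

end IForm

/-- A parametrized intuitionistic sequent calculus: `K` is the set of allowed
formulas (the fragment), `ax` the set of non-logical axioms, and the remaining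
fields tell which optional rules are available. -/
structure ICalc where
  K : IForm → Prop
  ax : Set IForm
  wL : Prop      -- unrestricted left weakening (W)
  wR : Prop      -- right weakening (W')
  bD : Prop      -- dereliction (!D)
  bP : Prop      -- promotion (!P)
  bF : Prop      -- functorial promotion (!F)
  bW : Prop      -- !-weakening (!W), for linear systems
  lB : Prop      -- the ILAL rule (!)
  lP : Prop      -- the ILAL rule (§)

/-- Provability of an intuitionistic sequent `Γ ⊢ X` (X a stoup) in the
parametrized calculus `C`. -/
inductive IPrv (C : ICalc) : Multiset IForm → Option IForm → Prop where
  | axiom' {B} : B ∈ C.ax → IPrv C 0 (some B)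
  | init {A} : C.K A → IPrv C {A} (some A)
  | oneR : C.K .one → IPrv C 0 (some .one)
  | botL : C.K .bot → IPrv C {.bot} none
  | topR {Γ} : C.K .top → (∀ A ∈ Γ, C.K A) → IPrv C Γ (some .top)
  | zeroL {Γ X} : C.K .zero → (∀ A ∈ Γ, C.K A) → (∀ A, X = some A → C.K A) →
      IPrv C (.zero ::ₘ Γ) X
  | cut {Γ Δ X A} : IPrv C Γ (some A) → IPrv C (A ::ₘ Δ) X → IPrv C (Γ + Δ) X
  | oneL {Γ X} : C.K .one → IPrv C Γ X → IPrv C (.one ::ₘ Γ) X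
  | botR {Γ} : C.K .bot → IPrv C Γ none → IPrv C Γ (some .bot)
  | limpL {Γ Δ X A B} : C.K (.limp A B) → IPrv C Γ (some A) → IPrv C (B ::ₘ Δ) X →
      IPrv C (.limp A B ::ₘ (Γ + Δ)) X
  | limpR {Γ A B} : C.K (.limp A B) → IPrv C (A ::ₘ Γ) (some B) →
      IPrv C Γ (some (.limp A B))
  | tensorL {Γ X A B} : C.K (.tensor A B) → IPrv C (A ::ₘ B ::ₘ Γ) X →
      IPrv C (.tensor A B ::ₘ Γ) X
  | tensorR {Γ Δ A B} : C.K (.tensor A B) → IPrv C Γ (some A) → IPrv C Δ (some B) →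
      IPrv C (Γ + Δ) (some (.tensor A B))
  | withL1 {Γ X A B} : C.K (.and A B) → IPrv C (A ::ₘ Γ) X → IPrv C (.and A B ::ₘ Γ) X
  | withL2 {Γ X A B} : C.K (.and A B) → IPrv C (B ::ₘ Γ) X → IPrv C (.and A B ::ₘ Γ) X
  | withR {Γ A B} : C.K (.and A B) → IPrv C Γ (some A) → IPrv C Γ (some B) →
      IPrv C Γ (some (.and A B))
  | plusL {Γ X A B} : C.K (.or A B) → IPrv C (A ::ₘ Γ) X → IPrv C (B ::ₘ Γ) X →
      IPrv C (.or A B ::ₘ Γ) X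
  | plusR1 {Γ A B} : C.K (.or A B) → IPrv C Γ (some A) → IPrv C Γ (some (.or A B))
  | plusR2 {Γ A B} : C.K (.or A B) → IPrv C Γ (some B) → IPrv C Γ (some (.or A B))
  | bangD {Γ X A} : C.bD → C.K (.bang A) → IPrv C (A ::ₘ Γ) X → IPrv C (.bang A ::ₘ Γ) X
  | bangP {Γ : Multiset IForm} {A} : C.bP → C.K (.bang A) → (∀ B ∈ Γ, C.K (.bang B)) →
      IPrv C (Γ.map .bang) (some A) → IPrv C (Γ.map .bang) (some (.bang A))
  | bangF {Γ : Multiset IForm} {A} : C.bF → C.K (.bang A) → (∀ B ∈ Γ, C.K (.bang B)) →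
      IPrv C Γ (some A) → IPrv C (Γ.map .bang) (some (.bang A))
  | weakL {Γ X A} : C.wL → C.K A → IPrv C Γ X → IPrv C (A ::ₘ Γ) X
  | bangW {Γ X A} : C.bW → C.K (.bang A) → IPrv C Γ X → IPrv C (.bang A ::ₘ Γ) X
  | bangC {Γ X A} : C.K (.bang A) → IPrv C (.bang A ::ₘ .bang A ::ₘ Γ) X →
      IPrv C (.bang A ::ₘ Γ) X
  | weakR {Γ A} : C.wR → C.K A → IPrv C Γ none → IPrv C Γ (some A)
  | lalBang {A} {E : Multiset IForm} : C.lB → C.K (.bang A) →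
      (∀ B ∈ E, C.K (.bang B)) → Multiset.card E ≤ 1 → IPrv C E (some A) →
      IPrv C (E.map .bang) (some (.bang A))
  | lalPara {Γ Δ : Multiset IForm} {A} : C.lP → C.K (.para A) → (∀ B ∈ Γ, C.K (.bang B)) →
      (∀ B ∈ Δ, C.K (.para B)) → IPrv C (Γ + Δ) (some A) →
      IPrv C (Γ.map .bang + Δ.map .para) (some (.para A))

/-- ILZW with a set of non-logical axioms. -/
def ILZWc (Φ : Set IForm) : ICalc :=
  ⟨IForm.inL, Φ, True, False, True, True, False, False, False, False⟩

/-- ILZW' = ILZW + right weakening, with a set of non-logical axioms. -/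
def ILZWpc (Φ : Set IForm) : ICalc :=
  ⟨IForm.inL, Φ, True, True, True, True, False, False, False, False⟩

/-- ILLW: the ⊥-free fragment of ILZW. -/
def ILLWc (Φ : Set IForm) : ICalc :=
  ⟨IForm.inLp, Φ, True, False, True, True, False, False, False, False⟩

/-- IEZW: intuitionistic elementary affine logic with bottom. -/
def IEZWc (Φ : Set IForm) : ICalc :=
  ⟨IForm.inL, Φ, True, False, False, False, True, False, False, False⟩

/-- IELW: the ⊥-free fragment of IEZW. -/
def IELWc (Φ : Set IForm) : ICalc :=
  ⟨IForm.inLp, Φ, True, False, False, False, True, False, False, False⟩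

/-- FLei: the {⊗,⊸,&,⊕,1,⊥}-fragment of ILZW. -/
def FLeic (Φ : Set IForm) : ICalc :=
  ⟨IForm.inFLei, Φ, True, False, True, True, False, False, False, False⟩

/-- FLew: the {⊗,⊸,&,⊕,1,⊥}-fragment of ILZW'. -/
def FLewc (Φ : Set IForm) : ICalc :=
  ⟨IForm.inFLei, Φ, True, True, True, True, False, False, False, False⟩

/-- FLei⁺: the {⊗,⊸,&,⊕,1}-fragment of ILZW. -/
def FLeiPc (Φ : Set IForm) : ICalc :=
  ⟨IForm.inFLeiP, Φ, True, False, True, True, False, False, False, False⟩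

/-- BCK: the {⊸}-fragment of ILZW. -/
def BCKc (Φ : Set IForm) : ICalc :=
  ⟨IForm.inImp, Φ, True, False, True, True, False, False, False, False⟩

/-- The {⊸,!}-fragment of ILLW. -/
def ImpBangILLWc (Φ : Set IForm) : ICalc :=
  ⟨IForm.inImpBang, Φ, True, False, True, True, False, False, False, False⟩

/-- ILL: intuitionistic linear logic (no unrestricted weakening, only !W). -/
def ILLc (Φ : Set IForm) : ICalc :=
  ⟨IForm.inLp, Φ, False, False, True, True, False, True, False, False⟩

/-- BCI: the {⊸}-fragment of ILL. -/
def BCIc (Φ : Set IForm) : ICalc :=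
  ⟨IForm.inImp, Φ, False, False, True, True, False, True, False, False⟩

/-- ILAL: intuitionistic light affine logic. -/
def ILALc (Φ : Set IForm) : ICalc :=
  ⟨IForm.inLAL, Φ, True, False, False, False, False, False, True, True⟩

/-- Classical formulas: literals p, p⊥ and the connectives ⊗, ⅋, &, ⊕, 1, ⊥, ⊤, 0, !, ?. -/
inductive CForm : Type where
  | pos (n : ℕ)
  | neg (n : ℕ)
  | one
  | bot
  | top
  | zero
  | tensor (A B : CForm)
  | par (A B : CForm)
  | and (A B : CForm)
  | or (A B : CForm)
  | bang (A : CForm)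
  | quest (A : CForm)

namespace CForm

/-- De Morgan (involutive) negation. -/
def dual : CForm → CForm
  | pos n => neg n
  | neg n => pos n
  | one => bot
  | bot => one
  | top => zero
  | zero => top
  | tensor A B => par A.dual B.dual
  | par A B => tensor A.dual B.dual
  | and A B => or A.dual B.dual
  | or A B => and A.dual B.dual
  | bang A => quest A.dual
  | quest A => bang A.dual

/-- the propositional variable `x` occurs in the formula -/
def hasVar (x : ℕ) : CForm → Prop
  | pos n => n = x
  | neg n => n = x
  | one => False
  | bot => False
  | top => False
  | zero => False
  | tensor A B => hasVar x A ∨ hasVar x B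
  | par A B => hasVar x A ∨ hasVar x B
  | and A B => hasVar x A ∨ hasVar x B
  | or A B => hasVar x A ∨ hasVar x B
  | bang A => hasVar x A
  | quest A => hasVar x A

/-- {⊗,⅋,&,⊕,1,⊥}-formulas (the language of InFLew) -/
def inMALL : CForm → Prop
  | pos _ => True
  | neg _ => True
  | one => True
  | bot => True
  | tensor A B => inMALL A ∧ inMALL B
  | par A B => inMALL A ∧ inMALL B
  | and A B => inMALL A ∧ inMALL B
  | or A B => inMALL A ∧ inMALL B
  | _ => False

end CForm

/-- A parametrized one-sided classical sequent calculus. -/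
structure CCalc where
  K : CForm → Prop
  ax : Set CForm
  wk : Prop      -- unrestricted weakening (W)
  der : Prop     -- dereliction (?)
  prom : Prop    -- promotion (!)
  funcF : Prop   -- the functorial rule (F) of ELLW
  qW : Prop      -- ?-weakening (?W), for LL

/-- Provability of a one-sided sequent `⊢ Γ` in the parametrized calculus `C`. -/
inductive CPrv (C : CCalc) : Multiset CForm → Prop where
  | axiom' {B} : B ∈ C.ax → CPrv C {B}
  | init {A} : C.K A → C.K A.dual → CPrv C {A, A.dual}
  | one : C.K .one → CPrv C {.one}
  | top {Γ} : C.K .top → (∀ A ∈ Γ, C.K A) → CPrv C (.top ::ₘ Γ)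
  | cut {Γ Δ A} : CPrv C (A ::ₘ Γ) → CPrv C (A.dual ::ₘ Δ) → CPrv C (Γ + Δ)
  | bot {Γ} : C.K .bot → CPrv C Γ → CPrv C (.bot ::ₘ Γ)
  | tensor {Γ Δ A B} : C.K (.tensor A B) → CPrv C (A ::ₘ Γ) → CPrv C (B ::ₘ Δ) →
      CPrv C (.tensor A B ::ₘ (Γ + Δ))
  | par {Γ A B} : C.K (.par A B) → CPrv C (A ::ₘ B ::ₘ Γ) → CPrv C (.par A B ::ₘ Γ)
  | with' {Γ A B} : C.K (.and A B) → CPrv C (A ::ₘ Γ) → CPrv C (B ::ₘ Γ) →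
      CPrv C (.and A B ::ₘ Γ)
  | plus1 {Γ A B} : C.K (.or A B) → CPrv C (A ::ₘ Γ) → CPrv C (.or A B ::ₘ Γ)
  | plus2 {Γ A B} : C.K (.or A B) → CPrv C (B ::ₘ Γ) → CPrv C (.or A B ::ₘ Γ)
  | der {Γ A} : C.der → C.K (.quest A) → CPrv C (A ::ₘ Γ) → CPrv C (.quest A ::ₘ Γ)
  | prom {Γ : Multiset CForm} {A} : C.prom → C.K (.bang A) → (∀ B ∈ Γ, C.K (.quest B)) →
      CPrv C (A ::ₘ Γ.map .quest) → CPrv C (.bang A ::ₘ Γ.map .quest)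
  | wk {Γ A} : C.wk → C.K A → CPrv C Γ → CPrv C (A ::ₘ Γ)
  | questW {Γ A} : C.qW → C.K (.quest A) → CPrv C Γ → CPrv C (.quest A ::ₘ Γ)
  | questC {Γ A} : C.K (.quest A) → CPrv C (.quest A ::ₘ .quest A ::ₘ Γ) →
      CPrv C (.quest A ::ₘ Γ)
  | funcF {Γ : Multiset CForm} {A} : C.funcF → C.K (.bang A) → (∀ B ∈ Γ, C.K (.quest B)) →
      CPrv C (A ::ₘ Γ) → CPrv C (.bang A ::ₘ Γ.map .quest)

/-- LLW: classical affine logic, with a set of non-logical axioms. -/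
def LLWc (Φ : Set CForm) : CCalc :=
  ⟨fun _ => True, Φ, True, True, True, False, False⟩

/-- ELLW: classical elementary affine logic. -/
def ELLWc (Φ : Set CForm) : CCalc :=
  ⟨fun _ => True, Φ, True, False, False, True, False⟩

/-- InFLew: the {⊗,⅋,&,⊕,1,⊥}-fragment of LLW. -/
def InFLewc (Φ : Set CForm) : CCalc :=
  ⟨CForm.inMALL, Φ, True, False, False, False, False⟩

/-- LL: classical linear logic (weakening restricted to ?W). -/
def LLc (Φ : Set CForm) : CCalc :=
  ⟨fun _ => True, Φ, False, True, True, False, True⟩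

/-- The translation (·)^[F] of classical formulas into intuitionistic formulas,
where ¬_F B := B ⊸ F. -/
def trF (F : IForm) : CForm → IForm
  | .pos n => .limp (.var n) F
  | .neg n => .var n
  | .one => .limp .one F
  | .bot => .one
  | .top => .zero
  | .zero => .limp .zero F
  | .tensor B C => .limp (.limp (trF F B) F) (trF F C)
  | .par B C => .limp (.limp (trF F B) (.limp (trF F C) F)) F
  | .and B C => .or (trF F B) (trF F C)
  | .or B C => .limp (.or (.limp (trF F B) F) (.limp (trF F C) F)) F
  | .bang B => .limp (.bang (.limp (trF F B) F)) F
  | .quest B => .bang (trF F B)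

/-- The embedding (·)̲ of ⊥-free intuitionistic formulas into classical formulas. -/
def emb : IForm → CForm
  | .var n => .pos n
  | .one => .one
  | .top => .top
  | .bot => .bot
  | .zero => .zero
  | .tensor A B => .tensor (emb A) (emb B)
  | .limp A B => .par (emb A).dual (emb B)
  | .and A B => .and (emb A) (emb B)
  | .or A B => .or (emb A) (emb B)
  | .bang A => .bang (emb A)
  | .para A => .bang (emb A)

end Affine

namespace Affine

theorem trF_inLp {F : IForm} (hF : F.inLp) (A : CForm) : (trF F A).inLp := by
  induction A <;> simp_all [trF, IForm.inLp]

/-- Modus ponens on the left: from `Γ ⊢ A` infer `A ⊸ F, Γ ⊢ F`. -/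
theorem IPrv.limp_elim {C : ICalc} {Γ : Multiset IForm} {A F : IForm}
    (hK : C.K (.limp A F)) (hF : C.K F) (h : IPrv C Γ (some A)) :
    IPrv C (.limp A F ::ₘ Γ) (some F) := by
  simpa using IPrv.limpL (Δ := 0) hK h (.init hF)

section

variable {C : ICalc} {F b b' c c' : IForm}

theorem IPrv.tensor_par (hC : C.K = IForm.inLp) (hF : F.inLp) (hb : b.inLp) (hb' : b'.inLp)
    (hc : c.inLp) (hc' : c'.inLp) (h₁ : IPrv C {b, b'} (some F)) (h₂ : IPrv C {c, c'} (some F)) :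
    IPrv C {.limp (.limp b F) c, .limp (.limp b' (.limp c' F)) F} (some F) := by
  rw [Multiset.pair_comm]
  refine .limp_elim (by simp_all [IForm.inLp]) (hC ▸ hF)
    (.limpR (by simp_all [IForm.inLp]) (.limpR (by simp_all [IForm.inLp]) ?_))
  have h := IPrv.limpL (Γ := {b'}) (Δ := {c'}) (A := .limp b F) (B := c) (X := some F)
    (by simp_all [IForm.inLp]) (.limpR (by simp_all [IForm.inLp]) h₁) h₂
  convert h using 1
  simp only [← Multiset.singleton_add]
  abel

theorem IPrv.and_or (hC : C.K = IForm.inLp) (hF : F.inLp) (hb : b.inLp) (hb' : b'.inLp)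
    (hc : c.inLp) (hc' : c'.inLp) (h₁ : IPrv C {b, b'} (some F)) (h₂ : IPrv C {c, c'} (some F)) :
    IPrv C {.or b c, .limp (.or (.limp b' F) (.limp c' F)) F} (some F) := by
  rw [Multiset.pair_comm] at h₁ h₂ ⊢
  exact .limp_elim (by simp_all [IForm.inLp]) (hC ▸ hF) (.plusL (by simp_all [IForm.inLp])
    (.plusR1 (by simp_all [IForm.inLp]) (.limpR (by simp_all [IForm.inLp]) h₁))
    (.plusR2 (by simp_all [IForm.inLp]) (.limpR (by simp_all [IForm.inLp]) h₂)))

theorem IPrv.bang_quest (hC : C.K = IForm.inLp)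
    (hbang : ∀ A B : IForm, A.inLp → B.inLp → IPrv C {A} (some B) →
      IPrv C {.bang A} (some (.bang B)))
    (hF : F.inLp) (hb : b.inLp) (hb' : b'.inLp) (h : IPrv C {b, b'} (some F)) :
    IPrv C {.limp (.bang (.limp b F)) F, .bang b'} (some F) :=
  .limp_elim (by simp_all [IForm.inLp]) (hC ▸ hF)
    (hbang _ _ hb' (by simp_all [IForm.inLp]) (.limpR (by simp_all [IForm.inLp]) h))

end

/-- A calculus on the ⊥-free language in which `!` is monotone proves `A^[F], (A⊥)^[F] ⊢ F`. -/
theorem trF_dual_of_bang_mono {C : ICalc} (hC : C.K = IForm.inLp)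
    (hbang : ∀ A B : IForm, A.inLp → B.inLp → IPrv C {A} (some B) →
      IPrv C {.bang A} (some (.bang B)))
    {F : IForm} (hF : F.inLp) (A : CForm) : IPrv C {trF F A, trF F A.dual} (some F) := by
  have hK : ∀ A, (trF F A).inLp := trF_inLp hF
  have atom : ∀ x : IForm, x.inLp → IPrv C {.limp x F, x} (some F) := fun x hx =>
    .limp_elim (by simp_all [IForm.inLp]) (hC ▸ hF) (.init (hC ▸ hx))
  induction A with
  | pos n => exact atom _ trivial
  | neg n => rw [Multiset.pair_comm]; exact atom _ trivial
  | one => exact atom _ trivial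
  | bot => rw [Multiset.pair_comm]; exact atom _ trivial
  | top => rw [Multiset.pair_comm]; exact atom _ trivial
  | zero => exact atom _ trivial
  | tensor A B hA hB => exact .tensor_par hC hF (hK _) (hK _) (hK _) (hK _) hA hB
  | par A B hA hB =>
    rw [Multiset.pair_comm] at hA hB ⊢
    exact .tensor_par hC hF (hK _) (hK _) (hK _) (hK _) hA hB
  | and A B hA hB => exact .and_or hC hF (hK _) (hK _) (hK _) (hK _) hA hB
  | or A B hA hB =>
    rw [Multiset.pair_comm] at hA hB ⊢
    exact .and_or hC hF (hK _) (hK _) (hK _) (hK _) hA hB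
  | bang A hA => exact .bang_quest hC hbang hF (hK _) (hK _) hA
  | quest A hA =>
    rw [Multiset.pair_comm] at hA ⊢
    exact .bang_quest hC hbang hF (hK _) (hK _) hA

/-- For any classical formula A and ⊥-free intuitionistic formula F,
the sequent `A^[F], (A⊥)^[F] ⊢ F` is provable in ILLW and in IELW. -/
theorem trF_dual_provable (A : CForm) (F : IForm) (hF : F.inLp) :
    IPrv (ILLWc ∅) {trF F A, trF F A.dual} (some F) ∧
    IPrv (IELWc ∅) {trF F A, trF F A.dual} (some F) := by
  refine ⟨trF_dual_of_bang_mono rfl (fun A B hA hB h => ?_) hF A,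
    trF_dual_of_bang_mono rfl (fun A B hA hB h => ?_) hF A⟩
  · exact IPrv.bangP (Γ := {A}) trivial hB (fun D hD => by
      rw [Multiset.mem_singleton.1 hD]; exact hA) (.bangD (Γ := 0) trivial hA h)
  · exact IPrv.bangF (Γ := {A}) trivial hB (fun D hD => by
      rw [Multiset.mem_singleton.1 hD]; exact hA) h

end Affine
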